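/- arXiv:2003.09981 — 14 statements merged into one kernel-verified Lean document; each statement's English description precedes it below -/
import Mathlib

section
/- Let n be an even positive integer and let S be a Seidel matrix of order n. Then det(S) is an odd integer; in particular S is nonsingular. -/
/-- A Seidel matrix: a symmetric integer matrix with zero diagonal whose
off-diagonal entries are all `1` or `-1`. -/
def IsSeidel {n : ℕ} (S : Matrix (Fin n) (Fin n) ℤ) : Prop :=
  S.IsSymm ∧ (∀ i, S i i = 0) ∧ ∀ i j, i ≠ j → S i j = 1 ∨ S i j = -1

/-- Modulo `2`, a Seidel matrix is the identity plus the all-ones matrix. -/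
theorem IsSeidel.map_castRingHom_zmod_two {n : ℕ} {S : Matrix (Fin n) (Fin n) ℤ}
    (hS : IsSeidel S) :
    (Int.castRingHom (ZMod 2)).mapMatrix S =
      1 + Matrix.replicateCol Unit (1 : Fin n → ZMod 2) *
        Matrix.replicateRow Unit (1 : Fin n → ZMod 2) := by
  ext i j
  obtain rfl | hij := eq_or_ne i j
  · simpa [Matrix.mul_apply, hS.2.1 i] using (CharTwo.add_self_eq_zero (1 : ZMod 2)).symm
  · rcases hS.2.2 i j hij with h | h <;> simp [Matrix.mul_apply, h, hij]

/-- Modulo `2`, the determinant of a Seidel matrix of order `n` is `1 + n`. -/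
theorem IsSeidel.det_cast_zmod_two {n : ℕ} {S : Matrix (Fin n) (Fin n) ℤ}
    (hS : IsSeidel S) : (S.det : ZMod 2) = 1 + n := by
  rw [← eq_intCast (Int.castRingHom (ZMod 2)), RingHom.map_det, hS.map_castRingHom_zmod_two,
    Matrix.det_one_add_replicateCol_mul_replicateRow]
  simp

theorem stmt_0 (n : ℕ) (hn : 0 < n) (heven : Even n)
    (S : Matrix (Fin n) (Fin n) ℤ) (hS : IsSeidel S) :
    Odd S.det ∧ S.det ≠ 0 := by
  have hodd : Odd S.det := by
    rw [← ZMod.intCast_eq_one_iff_odd, hS.det_cast_zmod_two,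
      (ZMod.natCast_eq_zero_iff_even).mpr heven, add_zero]
  exact ⟨hodd, fun h => by simp [h] at hodd⟩
end

section
/- Let n be an odd positive integer and let S be a Seidel matrix of order n. Then the rank of S (as a matrix over ℚ) is at least n − 1. -/
namespace Matrix

/-- Over a ring of characteristic two, `J - I` of even order is its own inverse. -/
theorem of_ite_eq_mul_self_of_even_card {ι R : Type*} [Fintype ι] [DecidableEq ι] [CommRing R]
    [CharP R 2] (h : Even (Fintype.card ι)) :
    (of fun i j : ι => if i = j then (0 : R) else 1) * (of fun i j => if i = j then 0 else 1)
      = 1 := by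
  have hJ : (of fun i j : ι => if i = j then (0 : R) else 1) = of (fun _ _ => 1) - 1 := by
    ext i j
    by_cases hij : i = j <;> simp [hij]
  have hcard : (Fintype.card ι : R) = 0 :=
    (CharP.cast_eq_zero_iff R 2 _).2 h.two_dvd
  have hJJ : (of fun _ _ : ι => (1 : R)) * of (fun _ _ => 1) = 0 := by
    ext i j
    simp [mul_apply, hcard]
  have hJ2 : (of fun _ _ : ι => (1 : R)) + of (fun _ _ => 1) = 0 := by
    ext i j
    exact CharTwo.add_self_eq_zero (1 : R)
  rw [hJ, sub_mul, mul_sub, hJJ, one_mul, mul_one, ← sub_add, zero_sub, ← neg_add', hJ2, neg_zero,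
    zero_add]

/-- An integer matrix of even order with even diagonal and odd off-diagonal entries has
odd determinant. -/
theorem odd_det_of_even_diag_of_odd_offDiag {ι : Type*} [Fintype ι] [DecidableEq ι]
    (h : Even (Fintype.card ι)) {A : Matrix ι ι ℤ} (hdiag : ∀ i, Even (A i i))
    (hoff : ∀ i j, i ≠ j → Odd (A i j)) : Odd A.det := by
  have hA : A.map (Int.castRingHom (ZMod 2)) = of fun i j => if i = j then 0 else 1 := by
    ext i j
    by_cases hij : i = j
    · subst hij
      simpa using (ZMod.intCast_eq_zero_iff_even).2 (hdiag i)
    · simpa [hij] using (ZMod.intCast_eq_one_iff_odd).2 (hoff i j hij)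
  rw [← Int.not_even_iff_odd, ← ZMod.intCast_eq_zero_iff_even]
  intro h0
  have hdet : (A.map (Int.castRingHom (ZMod 2))).det = 0 := by
    rw [← RingHom.mapMatrix_apply, ← RingHom.map_det]
    simpa using h0
  have hmul := congrArg det (of_ite_eq_mul_self_of_even_card (R := ZMod 2) h)
  rw [det_mul, ← hA, hdet, zero_mul, det_one] at hmul
  exact zero_ne_one hmul

end Matrix

theorem stmt_1 (n : ℕ) (hn : 0 < n) (hodd : Odd n)
    (S : Matrix (Fin n) (Fin n) ℤ) (hS : IsSeidel S) :
    n - 1 ≤ (S.map (Int.cast : ℤ → ℚ)).rank := by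
  obtain ⟨-, hdiag, hoff⟩ := hS
  obtain ⟨m, rfl⟩ := Nat.exists_eq_succ_of_ne_zero hn.ne'
  have hm : Even m := by simpa [parity_simps] using hodd
  have hdet : Odd (S.submatrix Fin.castSucc Fin.castSucc).det := by
    refine Matrix.odd_det_of_even_diag_of_odd_offDiag (by simpa using hm) (by simp [hdiag])
      fun i j hij => ?_
    rcases hoff i.castSucc j.castSucc (by simpa using hij) with h | h <;> simp [h]
  have hunit : IsUnit ((S.map (Int.cast : ℤ → ℚ)).submatrix Fin.castSucc Fin.castSucc) := by
    rw [Matrix.isUnit_iff_isUnit_det, isUnit_iff_ne_zero, Matrix.submatrix_map,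
      ← Int.cast_det, Int.cast_ne_zero]
    rintro h
    simp [h] at hdet
  calc m = _ := by simpa using (Matrix.rank_of_isUnit _ hunit).symm
    _ ≤ _ := Matrix.rank_submatrix_le _ _ _
end

section
/- Let n be an odd positive integer and let S be a Seidel matrix of order n with symmetric spectrum. Then 0 is an eigenvalue of S of multiplicity exactly 1; that is, 0 is a root of the characteristic polynomial of S of multiplicity exactly 1. -/
open Polynomial

/-- Modulo 2, a Seidel matrix is the all-ones matrix minus the identity. -/
lemma IsSeidel.map_zmod_two {n : ℕ} {S : Matrix (Fin n) (Fin n) ℤ} (hS : IsSeidel S) :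
    S.map (Int.castRingHom (ZMod 2)) = Matrix.vecMulVec 1 1 - Matrix.scalar (Fin n) 1 := by
  ext i j
  rcases eq_or_ne i j with rfl | hij
  · simp [hS.2.1 i]
  · rcases hS.2.2 i j hij with h | h <;> simp [h, hij]

lemma IsSeidel.charpoly_map_zmod_two {n : ℕ} (hodd : Odd n)
    {S : Matrix (Fin n) (Fin n) ℤ} (hS : IsSeidel S) :
    S.charpoly.map (Int.castRingHom (ZMod 2)) = X * (X + 1) ^ (n - 1) := by
  have hn : (n : ZMod 2) = 1 := ZMod.natCast_eq_one_iff_odd.2 hodd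
  obtain ⟨k, rfl⟩ := hodd
  rw [← Matrix.charpoly_map, hS.map_zmod_two, Matrix.charpoly_sub_scalar,
    Matrix.charpoly_vecMulVec, one_dotProduct_one, Fintype.card_fin, hn]
  simp only [one_smul, sub_comp, pow_comp, X_comp, C_1, Nat.add_sub_cancel]
  ring

theorem stmt_2 (n : ℕ) (hn : 0 < n) (hodd : Odd n)
    (S : Matrix (Fin n) (Fin n) ℤ) (hS : IsSeidel S)
    (hsym : S.charpoly.comp (-X) = (-1) ^ n * S.charpoly) :
    Polynomial.rootMultiplicity 0 S.charpoly = 1 := by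
  have h0 : S.charpoly ≠ 0 := S.charpoly_monic.ne_zero
  refine le_antisymm ?_ ?_
  · rw [rootMultiplicity_le_iff h0, C_0, sub_zero]
    intro hdvd
    have hmap := map_dvd (mapRingHom (Int.castRingHom (ZMod 2))) hdvd
    rw [coe_mapRingHom, hS.charpoly_map_zmod_two hodd, Polynomial.map_pow, map_X, pow_succ,
      pow_one, mul_dvd_mul_iff_left X_ne_zero, X_dvd_iff, coeff_zero_eq_eval_zero] at hmap
    simp at hmap
  · rw [Nat.one_le_iff_ne_zero, ← Nat.pos_iff_ne_zero, rootMultiplicity_pos h0, IsRoot.def]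
    have h := congrArg (eval 0) hsym
    simp only [hodd.neg_one_pow, eval_comp, eval_neg, eval_X, neg_zero, neg_one_mul] at h
    lia
end

section
/- Let k be a positive integer and let B be a symmetric k×k (0,1)-matrix with zero diagonal (the adjacency matrix of an arbitrary simple graph G on k vertices). Let A be the matrix of order n = 2k given in block form by A = [[J − I − 2B, J], [J, −(J − I − 2B)]], where J is the all-ones k×k matrix (A is the adjacency matrix of the complete signed graph on n vertices whose negative edges induce the disjoint union of G and the complement of G). Then A has symmetric spectrum; in fact its characteristic polynomial p satisfies p(−x) = p(x). -/
open Polynomial Matrix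

/-- Substituting `-X` in the characteristic polynomial of `M` gives that of `-M`, up to sign. -/
theorem Matrix.charpoly_comp_neg_X {n R : Type*} [Fintype n] [DecidableEq n] [CommRing R]
    (M : Matrix n n R) :
    M.charpoly.comp (-X) = (-1) ^ Fintype.card n * (-M).charpoly := by
  rw [charpoly, charpoly, ← det_neg, ← coe_compRingHom_apply, RingHom.map_det]
  congr 1
  ext1 i j
  by_cases h : i = j
  · subst h
    simp
    ring
  · simp [h]

/-- A block matrix `[[S, T], [T, -S]]` has the same characteristic polynomial as its negative. -/
theorem Matrix.charpoly_neg_fromBlocks_neg {n R : Type*} [Fintype n] [DecidableEq n] [CommRing R]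
    (S T : Matrix n n R) :
    (-fromBlocks S T T (-S)).charpoly = (fromBlocks S T T (-S)).charpoly := by
  let Q : (Matrix (n ⊕ n) (n ⊕ n) R)ˣ :=
    { val := fromBlocks 0 1 (-1) 0
      inv := fromBlocks 0 (-1) 1 0
      val_inv := by simp [fromBlocks_multiply, fromBlocks_one]
      inv_val := by simp [fromBlocks_multiply, fromBlocks_one] }
  rw [← charpoly_units_conj Q (fromBlocks S T T (-S)), ← coe_units_inv]
  congr 1
  change _ = fromBlocks 0 1 (-1) 0 * fromBlocks S T T (-S) * fromBlocks 0 (-1) 1 0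
  simp [fromBlocks_multiply, fromBlocks_neg]

theorem stmt_3 (k : ℕ) (hk : 0 < k)
    (B : Matrix (Fin k) (Fin k) ℤ) (hBsymm : B.IsSymm)
    (hBdiag : ∀ i, B i i = 0)
    (hB01 : ∀ i j, B i j = 0 ∨ B i j = 1)
    (J : Matrix (Fin k) (Fin k) ℤ) (hJ : ∀ i j, J i j = 1) :
    letI A : Matrix (Fin k ⊕ Fin k) (Fin k ⊕ Fin k) ℤ :=
      Matrix.fromBlocks (J - 1 - 2 • B) J J (-(J - 1 - 2 • B))
    A.charpoly.comp (-X) = A.charpoly := by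
  rw [charpoly_comp_neg_X, charpoly_neg_fromBlocks_neg, Fintype.card_sum,
    Even.neg_one_pow (Even.add_self _), one_mul]
end

section
/- Let B and C be symmetric k×k integer matrices with all entries in {−1, 0, 1}, where B has zero diagonal. Then the block matrix A = [[B, C], [C, −B]] of order 2k is sign-symmetric; in fact Q · A · Qᵀ = −A for the signed permutation matrix Q = [[0, −I], [I, 0]]. -/
open Matrix

/-- A signed permutation matrix: exactly one nonzero entry in each row and each
column, every nonzero entry being `1` or `-1`. -/
def IsSignedPerm {m : Type*} [Fintype m] [DecidableEq m] (P : Matrix m m ℤ) : Prop :=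
  ∃ (σ : Equiv.Perm m) (ε : m → ℤ), (∀ i, ε i = 1 ∨ ε i = -1) ∧
    ∀ i j, P i j = if j = σ i then ε i else 0

theorem stmt_4 (k : ℕ)
    (B C : Matrix (Fin k) (Fin k) ℤ) (hBsymm : B.IsSymm) (hCsymm : C.IsSymm)
    (hBdiag : ∀ i, B i i = 0)
    (hB : ∀ i j, B i j = -1 ∨ B i j = 0 ∨ B i j = 1)
    (hC : ∀ i j, C i j = -1 ∨ C i j = 0 ∨ C i j = 1) :
    letI A : Matrix (Fin k ⊕ Fin k) (Fin k ⊕ Fin k) ℤ :=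
      Matrix.fromBlocks B C C (-B)
    letI Q : Matrix (Fin k ⊕ Fin k) (Fin k ⊕ Fin k) ℤ :=
      Matrix.fromBlocks 0 (-1) 1 0
    IsSignedPerm Q ∧ Q * A * Qᵀ = -A := by
  refine ⟨⟨Equiv.sumComm _ _, Sum.elim (fun _ => -1) (fun _ => 1), ?_, ?_⟩, ?_⟩
  · rintro (i | i) <;> simp
  · rintro (i | i) (j | j) <;> simp [Matrix.one_apply, eq_comm, neg_ite]
  · simp [Matrix.fromBlocks_transpose, Matrix.fromBlocks_multiply, Matrix.fromBlocks_neg]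
end

section
/- Let B₁ and B₂ be the adjacency matrices of self-complementary graphs G and H on m and n vertices respectively; that is, each Bᵢ is a symmetric (0,1)-matrix with zero diagonal and there is a permutation matrix Pᵢ with Pᵢ · Bᵢ · Pᵢᵀ = J − I − Bᵢ. Let S be the Seidel matrix of order m + n given in block form by S = [[J − I − 2B₁, −J], [−J, J − I − 2B₂]] (the adjacency matrix of the complete signed graph whose negative edges induce the join of G and H). Then S is sign-symmetric. -/
open Matrix

/-- Multiplying by permutation matrices on both sides reindexes rows and columns. -/
theorem permMatrix_mul_mul_transpose {m n R : Type*} [Fintype m] [DecidableEq m]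
    [Fintype n] [DecidableEq n] [NonAssocSemiring R] (σ : Equiv.Perm m) (τ : Equiv.Perm n)
    (M : Matrix m n R) :
    σ.permMatrix R * M * (τ.permMatrix R)ᵀ = M.submatrix σ τ := by
  ext i j
  simp [Matrix.mul_apply, PEquiv.toMatrix_apply, Equiv.toPEquiv_apply, Equiv.symm_apply_eq]

/-- A permutation taking a graph to its complement negates the Seidel matrix. -/
theorem seidel_submatrix_eq_neg {n : Type*} [DecidableEq n] (σ : Equiv.Perm n)
    (B : Matrix n n ℤ) (h : B.submatrix σ σ = (Matrix.of fun _ _ => 1) - 1 - B) :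
    ((Matrix.of fun _ _ => 1) - 1 - 2 • B : Matrix n n ℤ).submatrix σ σ =
      -((Matrix.of fun _ _ => 1) - 1 - 2 • B) := by
  ext i j
  have hij := congrFun (congrFun h i) j
  simp only [Matrix.submatrix_apply, Matrix.sub_apply, Matrix.neg_apply, Matrix.smul_apply,
    Matrix.of_apply, Matrix.one_apply, σ.injective.eq_iff, nsmul_eq_mul] at hij ⊢
  rw [hij]
  push_cast
  ring

/-- The block diagonal matrix of a permutation matrix and the negative of another one is a
signed permutation matrix. -/
theorem isSignedPerm_fromBlocks_neg {m n : Type*} [Fintype m] [DecidableEq m]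
    [Fintype n] [DecidableEq n] (σ : Equiv.Perm m) (τ : Equiv.Perm n) :
    IsSignedPerm (Matrix.fromBlocks (σ.permMatrix ℤ) 0 0 (-τ.permMatrix ℤ)) := by
  refine ⟨Equiv.sumCongr σ τ, Sum.elim (fun _ => 1) (fun _ => -1), ?_, ?_⟩
  · rintro (i | i) <;> simp
  · rintro (i | i) (j | j) <;>
      simp [PEquiv.toMatrix_apply, Equiv.toPEquiv_apply, eq_comm, apply_ite]

theorem stmt_7 (m n : ℕ)
    (B₁ : Matrix (Fin m) (Fin m) ℤ) (B₂ : Matrix (Fin n) (Fin n) ℤ)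
    (hB₁symm : B₁.IsSymm) (hB₂symm : B₂.IsSymm)
    (hB₁diag : ∀ i, B₁ i i = 0) (hB₂diag : ∀ i, B₂ i i = 0)
    (hB₁01 : ∀ i j, B₁ i j = 0 ∨ B₁ i j = 1)
    (hB₂01 : ∀ i j, B₂ i j = 0 ∨ B₂ i j = 1)
    (P₁ : Matrix (Fin m) (Fin m) ℤ) (P₂ : Matrix (Fin n) (Fin n) ℤ)
    (hP₁ : ∃ σ : Equiv.Perm (Fin m), P₁ = σ.permMatrix ℤ)
    (hP₂ : ∃ σ : Equiv.Perm (Fin n), P₂ = σ.permMatrix ℤ)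
    (hself₁ : P₁ * B₁ * P₁ᵀ = (Matrix.of fun _ _ => 1) - 1 - B₁)
    (hself₂ : P₂ * B₂ * P₂ᵀ = (Matrix.of fun _ _ => 1) - 1 - B₂) :
    letI S : Matrix (Fin m ⊕ Fin n) (Fin m ⊕ Fin n) ℤ :=
      Matrix.fromBlocks
        ((Matrix.of fun _ _ => 1) - 1 - 2 • B₁) (-(Matrix.of fun _ _ => 1))
        (-(Matrix.of fun _ _ => 1)) ((Matrix.of fun _ _ => 1) - 1 - 2 • B₂)
    ∃ P : Matrix (Fin m ⊕ Fin n) (Fin m ⊕ Fin n) ℤ,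
      IsSignedPerm P ∧ P * S * Pᵀ = -S := by
  obtain ⟨σ, rfl⟩ := hP₁
  obtain ⟨τ, rfl⟩ := hP₂
  rw [permMatrix_mul_mul_transpose] at hself₁ hself₂
  refine ⟨_, isSignedPerm_fromBlocks_neg σ τ, ?_⟩
  simp only [Matrix.fromBlocks_transpose, Matrix.fromBlocks_multiply, Matrix.transpose_neg,
    Matrix.transpose_zero, Matrix.zero_mul, Matrix.mul_zero, add_zero, zero_add, Matrix.neg_mul,
    Matrix.mul_neg, neg_neg, neg_zero, permMatrix_mul_mul_transpose, Matrix.fromBlocks_neg,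
    seidel_submatrix_eq_neg σ B₁ hself₁, seidel_submatrix_eq_neg τ B₂ hself₂]
  rfl
end

section
/- Let B₁ and B₂ be the adjacency matrices of self-complementary graphs G and H on m and n vertices respectively; that is, each Bᵢ is a symmetric (0,1)-matrix with zero diagonal and there is a permutation matrix Pᵢ with Pᵢ · Bᵢ · Pᵢᵀ = J − I − Bᵢ. Let S be the Seidel matrix of order m + n given in block form by S = [[J − I − 2B₁, J], [J, J − I − 2B₂]] (the adjacency matrix of the complete signed graph whose negative edges induce the disjoint union of G and H). Then S is sign-symmetric. -/
open Matrix

/-- Conjugating by a permutation matrix permutes rows and columns. -/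
theorem permMatrix_mul_mul_permMatrix_transpose {m n : Type*} [Fintype m] [DecidableEq m]
    [Fintype n] [DecidableEq n] (σ : Equiv.Perm m) (τ : Equiv.Perm n) (M : Matrix m n ℤ) :
    σ.permMatrix ℤ * M * (τ.permMatrix ℤ)ᵀ = M.submatrix σ τ := by
  rw [transpose_permMatrix, Equiv.Perm.permMatrix, PEquiv.toMatrix_toPEquiv_mul,
    Equiv.Perm.permMatrix, PEquiv.mul_toMatrix_toPEquiv]
  rfl

/-- A complementing permutation of `B` negates the Seidel matrix `J - I - 2B`. -/
theorem submatrix_seidel_eq_neg {m : Type*} [DecidableEq m] (σ : Equiv.Perm m)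
    (B : Matrix m m ℤ) (h : B.submatrix σ σ = (Matrix.of fun _ _ => 1) - 1 - B) :
    ((Matrix.of fun _ _ => 1) - 1 - 2 • B : Matrix m m ℤ).submatrix σ σ =
      -((Matrix.of fun _ _ => 1) - 1 - 2 • B : Matrix m m ℤ) := by
  ext i j
  have hij := congrFun (congrFun h i) j
  simp only [submatrix_apply, Matrix.sub_apply, of_apply, Matrix.smul_apply,
    Matrix.neg_apply, one_apply,
    σ.injective.eq_iff] at hij ⊢
  rw [hij]
  simp only [nsmul_eq_mul, Nat.cast_ofNat]
  ring

/-- The block sum of a permutation matrix and the negative of one is a signed permutation. -/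
theorem isSignedPerm_fromBlocks_permMatrix_neg {m n : Type*} [Fintype m] [DecidableEq m]
    [Fintype n] [DecidableEq n] (σ : Equiv.Perm m) (τ : Equiv.Perm n) :
    IsSignedPerm (fromBlocks (σ.permMatrix ℤ) 0 0 (-τ.permMatrix ℤ)) := by
  refine ⟨Equiv.sumCongr σ τ, Sum.elim (fun _ => 1) (fun _ => -1), ?_, ?_⟩
  · rintro (i | i) <;> simp
  · rintro (i | i) (j | j) <;>
      simp [Equiv.Perm.permMatrix, PEquiv.toMatrix_apply, eq_comm, apply_ite Neg.neg]

theorem stmt_8 (m n : ℕ)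
    (B₁ : Matrix (Fin m) (Fin m) ℤ) (B₂ : Matrix (Fin n) (Fin n) ℤ)
    (hB₁symm : B₁.IsSymm) (hB₂symm : B₂.IsSymm)
    (hB₁diag : ∀ i, B₁ i i = 0) (hB₂diag : ∀ i, B₂ i i = 0)
    (hB₁01 : ∀ i j, B₁ i j = 0 ∨ B₁ i j = 1)
    (hB₂01 : ∀ i j, B₂ i j = 0 ∨ B₂ i j = 1)
    (P₁ : Matrix (Fin m) (Fin m) ℤ) (P₂ : Matrix (Fin n) (Fin n) ℤ)
    (hP₁ : ∃ σ : Equiv.Perm (Fin m), P₁ = σ.permMatrix ℤ)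
    (hP₂ : ∃ σ : Equiv.Perm (Fin n), P₂ = σ.permMatrix ℤ)
    (hself₁ : P₁ * B₁ * P₁ᵀ = (Matrix.of fun _ _ => 1) - 1 - B₁)
    (hself₂ : P₂ * B₂ * P₂ᵀ = (Matrix.of fun _ _ => 1) - 1 - B₂) :
    letI S : Matrix (Fin m ⊕ Fin n) (Fin m ⊕ Fin n) ℤ :=
      Matrix.fromBlocks
        ((Matrix.of fun _ _ => 1) - 1 - 2 • B₁) (Matrix.of fun _ _ => 1)
        (Matrix.of fun _ _ => 1) ((Matrix.of fun _ _ => 1) - 1 - 2 • B₂)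
    ∃ P : Matrix (Fin m ⊕ Fin n) (Fin m ⊕ Fin n) ℤ,
      IsSignedPerm P ∧ P * S * Pᵀ = -S := by
  obtain ⟨σ, rfl⟩ := hP₁
  obtain ⟨τ, rfl⟩ := hP₂
  rw [permMatrix_mul_mul_permMatrix_transpose] at hself₁ hself₂
  refine ⟨_, isSignedPerm_fromBlocks_permMatrix_neg σ τ, ?_⟩
  simp only [fromBlocks_transpose, fromBlocks_multiply, fromBlocks_neg, transpose_neg,
    transpose_zero, Matrix.zero_mul, Matrix.mul_zero, add_zero, zero_add, Matrix.neg_mul,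
    Matrix.mul_neg, neg_neg, permMatrix_mul_mul_permMatrix_transpose,
    submatrix_seidel_eq_neg σ B₁ hself₁, submatrix_seidel_eq_neg τ B₂ hself₂]
  rfl
end

section
/- Let B be the adjacency matrix of a self-complementary graph G on n vertices; that is, B is a symmetric (0,1)-matrix with zero diagonal and there is a permutation matrix P with P · B · Pᵀ = J − I − B. Let S be the Seidel matrix of order n + 1 given in block form by S = [[J − I − 2B, j], [jᵀ, 0]], where j is the all-ones column vector of length n (the adjacency matrix of the complete signed graph of order n + 1 whose negative edges are exactly the edges of G). Then S is sign-symmetric. -/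
open Matrix

/-- Conjugation by a signed permutation matrix permutes the entries and multiplies them by signs. -/
theorem signedPerm_conj_apply {m : Type*} [Fintype m] [DecidableEq m] (σ : Equiv.Perm m)
    (ε : m → ℤ) (A : Matrix m m ℤ) (i j : m) :
    ((Matrix.of fun i j => if j = σ i then ε i else 0) * A *
      (Matrix.of fun i j => if j = σ i then ε i else 0)ᵀ) i j =
      ε i * A (σ i) (σ j) * ε j := by
  simp [Matrix.mul_apply]

theorem permMatrix_conj_apply {m : Type*} [Fintype m] [DecidableEq m] (σ : Equiv.Perm m)
    (A : Matrix m m ℤ) (i j : m) :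
    (σ.permMatrix ℤ * A * (σ.permMatrix ℤ)ᵀ) i j = A (σ i) (σ j) := by
  have h : σ.permMatrix ℤ = Matrix.of fun i j => if j = σ i then (1 : ℤ) else 0 := by
    ext i j
    simp [Equiv.Perm.permMatrix, PEquiv.toMatrix_apply, eq_comm]
  rw [h, signedPerm_conj_apply σ (fun _ => 1)]
  simp

theorem stmt_9 (n : ℕ)
    (B : Matrix (Fin n) (Fin n) ℤ) (hBsymm : B.IsSymm)
    (hBdiag : ∀ i, B i i = 0)
    (hB01 : ∀ i j, B i j = 0 ∨ B i j = 1)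
    (P : Matrix (Fin n) (Fin n) ℤ)
    (hP : ∃ σ : Equiv.Perm (Fin n), P = σ.permMatrix ℤ)
    (hself : P * B * Pᵀ = (Matrix.of fun _ _ => 1) - 1 - B) :
    letI S : Matrix (Fin n ⊕ Fin 1) (Fin n ⊕ Fin 1) ℤ :=
      Matrix.fromBlocks
        ((Matrix.of fun _ _ => 1) - 1 - 2 • B) (Matrix.of fun _ _ => 1)
        (Matrix.of fun _ _ => 1) 0
    ∃ Q : Matrix (Fin n ⊕ Fin 1) (Fin n ⊕ Fin 1) ℤ,
      IsSignedPerm Q ∧ Q * S * Qᵀ = -S := by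
  obtain ⟨σ, rfl⟩ := hP
  have hB (i j : Fin n) : B (σ i) (σ j) = 1 - (1 : Matrix (Fin n) (Fin n) ℤ) i j - B i j := by
    rw [← permMatrix_conj_apply σ B, hself]
    rfl
  let τ : Equiv.Perm (Fin n ⊕ Fin 1) := Equiv.sumCongr σ (Equiv.refl _)
  let ε : Fin n ⊕ Fin 1 → ℤ := Sum.elim (fun _ => 1) (fun _ => -1)
  refine ⟨Matrix.of fun i j => if j = τ i then ε i else 0, ⟨τ, ε, ?_, fun _ _ => rfl⟩, ?_⟩
  · rintro (i | i) <;> simp [ε]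
  · ext i j
    rw [signedPerm_conj_apply]
    rcases i with i | i <;> rcases j with j | j <;> simp [τ, ε, two_mul, hB, Matrix.one_apply]
    ring
end

section
/- Let A₁ and A₂ be adjacency matrices of signed graphs on m and n vertices (symmetric integer matrices with zero diagonal and entries in {−1, 0, 1}) such that there exist permutation matrices P₁ and P₂ with P₁ · A₁ · P₁ᵀ = −A₁ and P₂ · A₂ · P₂ᵀ = −A₂. Then the signed graph with adjacency matrix A = [[A₁, J], [J, A₂]] (the join of the two signed graphs in which all the joining edges are positive, J being the all-ones m×n matrix) is sign-symmetric. -/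
open Matrix

/-- Multiplying an all-ones matrix by permutation matrices on both sides leaves it unchanged. -/
theorem permMatrix_mul_ones_mul_transpose {m n : Type*} [Fintype m] [Fintype n]
    [DecidableEq m] [DecidableEq n] (σ : Equiv.Perm m) (τ : Equiv.Perm n) :
    σ.permMatrix ℤ * (Matrix.of fun _ _ => 1 : Matrix m n ℤ) * (τ.permMatrix ℤ)ᵀ =
      Matrix.of fun _ _ => 1 := by
  ext i j
  simp [Matrix.mul_apply, Equiv.Perm.permMatrix, PEquiv.toMatrix_apply, Equiv.symm_apply_eq,
    Finset.filter_eq']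

theorem stmt_10 (m n : ℕ)
    (A₁ : Matrix (Fin m) (Fin m) ℤ) (A₂ : Matrix (Fin n) (Fin n) ℤ)
    (hA₁symm : A₁.IsSymm) (hA₂symm : A₂.IsSymm)
    (hA₁diag : ∀ i, A₁ i i = 0) (hA₂diag : ∀ i, A₂ i i = 0)
    (hA₁ : ∀ i j, A₁ i j = -1 ∨ A₁ i j = 0 ∨ A₁ i j = 1)
    (hA₂ : ∀ i j, A₂ i j = -1 ∨ A₂ i j = 0 ∨ A₂ i j = 1)
    (P₁ : Matrix (Fin m) (Fin m) ℤ) (P₂ : Matrix (Fin n) (Fin n) ℤ)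
    (hP₁ : ∃ σ : Equiv.Perm (Fin m), P₁ = σ.permMatrix ℤ)
    (hP₂ : ∃ σ : Equiv.Perm (Fin n), P₂ = σ.permMatrix ℤ)
    (hneg₁ : P₁ * A₁ * P₁ᵀ = -A₁) (hneg₂ : P₂ * A₂ * P₂ᵀ = -A₂) :
    letI A : Matrix (Fin m ⊕ Fin n) (Fin m ⊕ Fin n) ℤ :=
      Matrix.fromBlocks A₁ (Matrix.of fun _ _ => 1) (Matrix.of fun _ _ => 1) A₂
    ∃ P : Matrix (Fin m ⊕ Fin n) (Fin m ⊕ Fin n) ℤ,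
      IsSignedPerm P ∧ P * A * Pᵀ = -A := by
  obtain ⟨σ, rfl⟩ := hP₁
  obtain ⟨τ, rfl⟩ := hP₂
  refine ⟨Matrix.fromBlocks (σ.permMatrix ℤ) 0 0 (-τ.permMatrix ℤ),
    ⟨Equiv.sumCongr σ τ, Sum.elim (fun _ => 1) (fun _ => -1), ?_, ?_⟩, ?_⟩
  · rintro (i | i) <;> simp
  · rintro (i | i) (j | j) <;>
      simp [Equiv.Perm.permMatrix, PEquiv.toMatrix_apply, eq_comm, apply_ite Neg.neg]
  · simp only [Matrix.fromBlocks_transpose, Matrix.fromBlocks_multiply, Matrix.fromBlocks_neg,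
      Matrix.transpose_zero, Matrix.transpose_neg, Matrix.zero_mul, Matrix.mul_zero,
      Matrix.neg_mul, Matrix.mul_neg, neg_neg, add_zero, zero_add, hneg₁, hneg₂,
      permMatrix_mul_ones_mul_transpose]
end

section
/- For a positive integer n, there exists a sign-symmetric Seidel matrix of order n (that is, a Seidel matrix S of order n together with a signed permutation matrix P such that P · S · Pᵀ = −S) if and only if n ≡ 0, 1, or 2 (mod 4). -/
open Matrix

/-- `S` is a Seidel matrix on `α`, and the signed permutation given by `σ` and `ε` carries `S`
to `-S`. -/
structure IsSignReversal {α : Type*} (S : α → α → ℤ) (σ : Equiv.Perm α) (ε : α → ℤ) : Prop where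
  symm : ∀ i j, S i j = S j i
  diag : ∀ i, S i i = 0
  off_diag : ∀ i j, i ≠ j → S i j = 1 ∨ S i j = -1
  sign : ∀ i, ε i = 1 ∨ ε i = -1
  reverse : ∀ i j, ε i * S (σ i) (σ j) * ε j = -S i j

namespace IsSignReversal

variable {α β : Type*} {S : α → α → ℤ} {σ : Equiv.Perm α} {ε : α → ℤ}

theorem comap (h : IsSignReversal S σ ε) (e : β ≃ α) :
    IsSignReversal (fun i j => S (e i) (e j)) ((e.trans σ).trans e.symm) (ε ∘ e) where
  symm _ _ := h.symm _ _
  diag _ := h.diag _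
  off_diag _ _ hij := h.off_diag _ _ (e.injective.ne hij)
  sign _ := h.sign _
  reverse i j := by simpa using h.reverse (e i) (e j)

/-- Adding a vertex joined to all others by positive edges. -/
theorem option (h : IsSignReversal S σ 1) :
    IsSignReversal
      (fun i j : Option α => i.elim (j.elim 0 fun _ => 1) fun a => j.elim 1 (S a))
      σ.optionCongr (fun i => i.elim (-1) 1) where
  symm i j := by
    rcases i with _ | i <;> rcases j with _ | j <;> simp
    exact h.symm i j
  diag i := by rcases i with _ | i <;> simp [h.diag]
  off_diag i j hij := by
    rcases i with _ | i <;> rcases j with _ | j <;> simp at hij ⊢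
    exact h.off_diag i j hij
  sign i := by rcases i with _ | i <;> simp
  reverse i j := by
    rcases i with _ | i <;> rcases j with _ | j <;> simp
    simpa using h.reverse i j

/-- The signs `1, -1, 1, -1`. -/
def alternatingSign : Fin 4 → ℤ := ![1, -1, 1, -1]

/-- The Seidel matrix whose negative edges form the path `0 - 3 - 1 - 2`; the rotation of `Fin 4`
negates it. -/
def pathFour : Fin 4 → Fin 4 → ℤ :=
  ![![0, 1, 1, -1], ![1, 0, -1, -1], ![1, -1, 0, 1], ![-1, -1, 1, 0]]

/-- Adding a path on four vertices whose two inner vertices are joined to all others by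
negative edges, and whose two end vertices are joined to them by positive ones. -/
theorem sum_fin_four (h : IsSignReversal S σ 1) :
    IsSignReversal
      (fun i j : α ⊕ Fin 4 => i.elim
        (fun a => j.elim (S a) alternatingSign)
        (fun a => j.elim (fun _ => alternatingSign a) (pathFour a)))
      (Equiv.sumCongr σ (finRotate 4)) 1 where
  symm i j := by
    rcases i with i | i <;> rcases j with j | j
    · exact h.symm i j
    · rfl
    · rfl
    · exact (by decide : ∀ i j, pathFour i j = pathFour j i) i j
  diag i := by
    rcases i with i | i
    · exact h.diag i
    · exact (by decide : ∀ i, pathFour i i = 0) i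
  off_diag i j hij := by
    have halt : ∀ i, alternatingSign i = 1 ∨ alternatingSign i = -1 := by decide
    rcases i with i | i <;> rcases j with j | j
    · exact h.off_diag i j (by simpa using hij)
    · exact halt j
    · exact halt i
    · exact (by decide : ∀ i j, i ≠ j → pathFour i j = 1 ∨ pathFour i j = -1) i j
        (by simpa using hij)
  sign i := by simp
  reverse i j := by
    have halt : ∀ i, alternatingSign (finRotate 4 i) = -alternatingSign i := by decide
    have hpath : ∀ i j, pathFour (finRotate 4 i) (finRotate 4 j) = -pathFour i j := by decide
    rcases i with i | i <;> rcases j with j | j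
    · simpa using h.reverse i j
    · simpa using halt j
    · simpa using halt i
    · simpa using hpath i j

theorem exists_one_of_subsingleton (α : Type*) [Subsingleton α] :
    ∃ (S : α → α → ℤ) (σ : Equiv.Perm α), IsSignReversal S σ 1 :=
  ⟨fun _ _ => 0, 1, ⟨by simp, by simp, fun i j hij => (hij (Subsingleton.elim i j)).elim,
    by simp, by simp⟩⟩

theorem exists_one_add_four_mul {r : ℕ}
    (h : ∃ (S : Fin r → Fin r → ℤ) (σ : Equiv.Perm (Fin r)), IsSignReversal S σ 1) (k : ℕ) :
    ∃ (S : Fin (r + 4 * k) → Fin (r + 4 * k) → ℤ) (σ : Equiv.Perm (Fin (r + 4 * k))),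
      IsSignReversal S σ 1 := by
  induction k with
  | zero => exact h
  | succ k ih =>
    obtain ⟨S, σ, h⟩ := ih
    exact ⟨_, _, h.sum_fin_four.comap finSumFinEquiv.symm⟩

end IsSignReversal

theorem Matrix.signedPerm_mul_mul_transpose_apply {m : Type*} [Fintype m] [DecidableEq m]
    {P S : Matrix m m ℤ} {σ : Equiv.Perm m} {ε : m → ℤ}
    (hP : ∀ i j, P i j = if j = σ i then ε i else 0) (i j : m) :
    (P * S * Pᵀ) i j = ε i * S (σ i) (σ j) * ε j := by
  simp [Matrix.mul_apply, hP]

theorem exists_isSeidel_signSymmetric_iff (n : ℕ) :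
    (∃ S : Matrix (Fin n) (Fin n) ℤ, IsSeidel S ∧
      ∃ P : Matrix (Fin n) (Fin n) ℤ, IsSignedPerm P ∧ P * S * Pᵀ = -S) ↔
    ∃ (S : Fin n → Fin n → ℤ) (σ : Equiv.Perm (Fin n)) (ε : Fin n → ℤ),
      IsSignReversal S σ ε := by
  constructor
  · rintro ⟨S, ⟨hs, hd, ho⟩, P, ⟨σ, ε, hε, hP⟩, h⟩
    refine ⟨S, σ, ε, fun i j => hs.apply j i, hd, ho, hε, fun i j => ?_⟩
    rw [← Matrix.signedPerm_mul_mul_transpose_apply hP, h, Matrix.neg_apply]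
  · rintro ⟨S, σ, ε, h⟩
    refine ⟨.of S, ⟨Matrix.IsSymm.ext fun i j => h.symm j i, h.diag, h.off_diag⟩,
      .of fun i j => if j = σ i then ε i else 0, ⟨σ, ε, h.sign, fun _ _ => rfl⟩, ?_⟩
    ext i j
    exact (Matrix.signedPerm_mul_mul_transpose_apply (fun _ _ => rfl) i j).trans (h.reverse i j)

/-- A sign reversal kills the signed count of triangles. -/
theorem IsSignReversal.trace_cube {m : Type*} [Fintype m] {S : Matrix m m ℤ}
    {σ : Equiv.Perm m} {ε : m → ℤ} (h : IsSignReversal S σ ε) : (S * S * S).trace = 0 := by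
  have hsum : (S * S * S).trace = ∑ i, ∑ j, ∑ k, S i k * S k j * S j i := by
    simp [Matrix.trace, Matrix.mul_apply, Finset.sum_mul]
  have hneg : (S * S * S).trace = -(S * S * S).trace := by
    rw [hsum]
    conv_lhs => rw [← Equiv.sum_comp σ]
    rw [← Finset.sum_neg_distrib]
    refine Finset.sum_congr rfl fun i _ => ?_
    rw [← Equiv.sum_comp σ, ← Finset.sum_neg_distrib]
    refine Finset.sum_congr rfl fun j _ => ?_
    rw [← Equiv.sum_comp σ, ← Finset.sum_neg_distrib]
    refine Finset.sum_congr rfl fun k _ => ?_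
    have hsq (a : m) : ε a * ε a = 1 := by rcases h.sign a with h | h <;> simp [h]
    calc S (σ i) (σ k) * S (σ k) (σ j) * S (σ j) (σ i)
        = (ε i * ε i) * (ε j * ε j) * (ε k * ε k) *
            (S (σ i) (σ k) * S (σ k) (σ j) * S (σ j) (σ i)) := by simp [hsq]
      _ = (ε i * S (σ i) (σ k) * ε k) * (ε k * S (σ k) (σ j) * ε j) *
            (ε j * S (σ j) (σ i) * ε i) := by ring
      _ = -(S i k * S k j * S j i) := by simp only [h.reverse]; ring
  omega

theorem Matrix.trace_cube_allOnes_sub_one (m : Type*) [Fintype m] [DecidableEq m] :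
    (((Matrix.of fun _ _ => 1) - 1) * ((Matrix.of fun _ _ => 1) - 1) *
      ((Matrix.of fun _ _ => 1) - 1) : Matrix m m ℤ).trace =
      (Fintype.card m : ℤ) * (Fintype.card m - 1) * (Fintype.card m - 2) := by
  set J : Matrix m m ℤ := Matrix.of fun _ _ => 1 with hJ
  have hJJ : J * J = (Fintype.card m : ℤ) • J := by
    ext i j
    simp [hJ, Matrix.mul_apply]
  have htr : J.trace = Fintype.card m := by simp [hJ, Matrix.trace]
  have : (J - 1) * (J - 1) * (J - 1) = J * J * J - 3 • (J * J) + 3 • J - 1 := by noncomm_ring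
  rw [this, hJJ, Matrix.smul_mul, hJJ]
  simp only [Matrix.trace_sub, Matrix.trace_add, Matrix.trace_smul, htr, Matrix.trace_one]
  simp only [smul_eq_mul, nsmul_eq_mul]
  push_cast
  ring

theorem Matrix.four_dvd_trace_cube_sub {m : Type*} [Fintype m] {B U : Matrix m m ℤ}
    (hB : B.IsSymm) :
    (4 : ℤ) ∣ ((B - 2 • (U + Uᵀ)) * (B - 2 • (U + Uᵀ)) * (B - 2 • (U + Uᵀ))).trace -
      (B * B * B).trace := by
  have hT : (B * B * Uᵀ).trace = (B * B * U).trace := by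
    rw [← Matrix.trace_transpose, Matrix.transpose_mul, Matrix.transpose_mul,
      Matrix.transpose_transpose, hB.eq, Matrix.trace_mul_comm]
  set A := U + Uᵀ with hA
  have hBBA : (B * B * A).trace = 2 * (B * B * U).trace := by
    rw [hA, Matrix.mul_add, Matrix.trace_add, hT]
    ring
  have h1 : (B * A * B).trace = (B * B * A).trace := by
    rw [Matrix.trace_mul_cycle]
  have h2 : (A * B * B).trace = (B * B * A).trace := by
    rw [← Matrix.trace_mul_cycle]
  have : (B - 2 • A) * (B - 2 • A) * (B - 2 • A) = B * B * B -
      2 • (B * B * A + B * A * B + A * B * B) +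
      4 • (B * A * A + A * B * A + A * A * B - 2 • (A * A * A)) := by
    noncomm_ring
  rw [this, Matrix.trace_add, Matrix.trace_sub, Matrix.trace_smul, Matrix.trace_smul,
    Matrix.trace_add, Matrix.trace_add, h1, h2, hBBA]
  simp only [nsmul_eq_mul]
  push_cast
  omega

theorem four_dvd_trace_cube_sub_of_signs {m : Type*} [Fintype m] [LinearOrder m]
    {S : Matrix m m ℤ} (hs : ∀ i j, S i j = S j i) (hd : ∀ i, S i i = 0)
    (ho : ∀ i j, i ≠ j → S i j = 1 ∨ S i j = -1) :
    (4 : ℤ) ∣ (S * S * S).trace -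
      (Fintype.card m : ℤ) * (Fintype.card m - 1) * (Fintype.card m - 2) := by
  let B : Matrix m m ℤ := (Matrix.of fun _ _ => 1) - 1
  let U : Matrix m m ℤ := Matrix.of fun i j => if i < j ∧ S i j = -1 then 1 else 0
  have hB : B.IsSymm := by
    ext i j
    simp [B, Matrix.one_apply, eq_comm]
  have hS : S = B - 2 • (U + Uᵀ) := by
    ext i j
    rw [Matrix.sub_apply, Matrix.smul_apply, Matrix.add_apply, Matrix.transpose_apply]
    rcases lt_trichotomy i j with h | rfl | h
    · rcases ho i j h.ne with h' | h' <;> simp [B, U, h.ne, h, h.not_gt, h']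
    · simp [B, U, hd]
    · rcases ho i j h.ne' with h' | h' <;> simp [B, U, h.ne', h, h.not_gt, h', hs j i]
  rw [← Matrix.trace_cube_allOnes_sub_one, hS]
  exact Matrix.four_dvd_trace_cube_sub hB

theorem stmt_11 (n : ℕ) (hn : 0 < n) :
    (∃ S : Matrix (Fin n) (Fin n) ℤ, IsSeidel S ∧
      ∃ P : Matrix (Fin n) (Fin n) ℤ, IsSignedPerm P ∧ P * S * Pᵀ = -S) ↔
    (n % 4 = 0 ∨ n % 4 = 1 ∨ n % 4 = 2) := by
  rw [exists_isSeidel_signSymmetric_iff]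
  constructor
  · rintro ⟨S, σ, ε, h⟩
    by_contra hmod
    have hdvd := four_dvd_trace_cube_sub_of_signs (S := S) h.symm h.diag h.off_diag
    rw [IsSignReversal.trace_cube (S := S) h, Fintype.card_fin] at hdvd
    obtain ⟨k, rfl⟩ : ∃ k, n = 4 * k + 3 := ⟨n / 4, by omega⟩
    obtain ⟨c, hc⟩ := hdvd
    push_cast at hc
    ring_nf at hc
    omega
  · intro hmod
    have hdiv := Nat.mod_add_div n 4
    generalize n / 4 = k at hdiv
    rcases hmod with h | h | h <;> rw [h] at hdiv <;> subst hdiv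
    · obtain ⟨S, σ, h⟩ := IsSignReversal.exists_one_add_four_mul
        (IsSignReversal.exists_one_of_subsingleton (Fin 0)) k
      exact ⟨S, σ, 1, h⟩
    · obtain ⟨S, σ, h⟩ := IsSignReversal.exists_one_add_four_mul
        (IsSignReversal.exists_one_of_subsingleton (Fin 1)) k
      exact ⟨S, σ, 1, h⟩
    · obtain ⟨S, σ, h⟩ := IsSignReversal.exists_one_add_four_mul
        (IsSignReversal.exists_one_of_subsingleton (Fin 1)) k
      rw [show 2 + 4 * k = 1 + 4 * k + 1 by ring]
      exact ⟨_, _, _, h.option.comap (finSuccEquiv (1 + 4 * k))⟩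
end

section
/- Let n be a positive integer with n ≡ 3 (mod 4) and let S be a Seidel matrix of order n. Then S is nonsingular (det S ≠ 0), and S does not have symmetric spectrum. -/
open Polynomial

theorem numDerangements_four_mul (k : ℕ) :
    (numDerangements (4 * k) : ZMod 4) = 1 ∧ (numDerangements (4 * k + 1) : ZMod 4) = 0 := by
  induction k with
  | zero => simp
  | succ k ih =>
    obtain ⟨h0, h1⟩ := ih
    have h4 : (4 : ZMod 4) = 0 := rfl
    rw [show 4 * (k + 1) = 4 * k + 2 + 2 by ring]
    simp only [numDerangements_add_two]
    push_cast
    simp only [h0, h1, h4]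
    ring_nf
    exact ⟨rfl, rfl⟩

theorem numDerangements_four_mul_add_three (k : ℕ) :
    (numDerangements (4 * k + 3) : ZMod 4) = 2 := by
  obtain ⟨h0, h1⟩ := numDerangements_four_mul k
  have h4 : (4 : ZMod 4) = 0 := rfl
  simp only [numDerangements_add_two]
  push_cast
  simp only [h0, h1, h4]
  ring

open Equiv.Perm in
theorem IsSeidel.sign_mul_prod_eq_one_or {n : ℕ} {S : Matrix (Fin n) (Fin n) ℤ} (hS : IsSeidel S)
    {σ : Equiv.Perm (Fin n)} (hσ : σ ∈ derangements (Fin n)) :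
    (sign σ : ℤ) * ∏ i, S (σ i) i = 1 ∨ (sign σ : ℤ) * ∏ i, S (σ i) i = -1 := by
  rw [← Int.isUnit_iff]
  refine (sign σ).isUnit.mul (IsUnit.prod_univ_iff.mpr fun i => ?_)
  exact Int.isUnit_iff.mpr (hS.2.2 _ _ (hσ i))

/-- Modulo `4`, the terms of the determinant indexed by `σ` and `σ⁻¹` add up to the same value,
whatever the signs of the entries. -/
theorem IsSeidel.det_eq_numDerangements {n : ℕ} (hn : Odd n) {S : Matrix (Fin n) (Fin n) ℤ}
    (hS : IsSeidel S) : (S.det : ZMod 4) = numDerangements n := by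
  classical
  have hfix : ∀ σ : Equiv.Perm (Fin n), σ ∉ derangements (Fin n) → ∏ i, S (σ i) i = 0 := by
    intro σ hσ
    simp only [derangements, Set.mem_ofPred_eq, not_forall, not_not] at hσ
    obtain ⟨i, hi⟩ := hσ
    exact Finset.prod_eq_zero (Finset.mem_univ i) (by rw [hi, hS.2.1])
  have hprod : ∀ σ : Equiv.Perm (Fin n), ∏ i, S (σ⁻¹ i) i = ∏ i, S (σ i) i := by
    intro σ
    rw [← Equiv.prod_comp σ]
    exact Finset.prod_congr rfl fun i _ => by simp [hS.1.apply i (σ i)]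
  have hinv : ∀ σ : Equiv.Perm (Fin n),
      σ⁻¹ ∈ derangements (Fin n) ↔ σ ∈ derangements (Fin n) := by
    intro σ
    simp only [derangements, Set.mem_ofPred_eq]
    exact forall_congr' fun i => not_congr (by rw [Equiv.Perm.inv_eq_iff_eq, eq_comm])
  have hcard : (numDerangements n : ZMod 4) =
      ∑ σ : Equiv.Perm (Fin n), if σ ∈ derangements (Fin n) then 1 else 0 := by
    rw [← card_derangements_fin_eq_numDerangements, Finset.sum_boole, Fintype.card_subtype]
  rw [hcard, ← sub_eq_zero, Matrix.det_apply', Int.cast_sum, ← Finset.sum_sub_distrib]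
  refine Finset.sum_involution (fun σ _ => σ⁻¹) (fun σ _ => ?_) (fun σ _ hne heq => hne ?_)
    (fun _ _ => Finset.mem_univ _) (fun _ _ => inv_inv _)
  · simp only [Equiv.Perm.sign_inv, hprod, hinv, Int.cast_id]
    by_cases hσ : σ ∈ derangements (Fin n)
    · rcases hS.sign_mul_prod_eq_one_or hσ with h | h <;> simp only [h, hσ, if_true] <;> rfl
    · simp [hσ, hfix σ hσ]
  · have hσ : σ ∉ derangements (Fin n) := by
      have h2 : ¬ 2 ∣ Fintype.card (Fin n) := by
        rw [Fintype.card_fin]; exact hn.not_two_dvd_nat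
      obtain ⟨i, hi⟩ := Equiv.Perm.exists_fixed_point_of_prime (p := 2) (n := 1) h2 (σ := σ)
        (by rw [pow_one, sq, ← inv_eq_iff_mul_eq_one, heq])
      exact fun h => h i hi
    simp [hσ, hfix σ hσ]

theorem Matrix.det_eq_zero_of_charpoly_comp_neg_X {n : ℕ} (hn : Odd n)
    {A : Matrix (Fin n) (Fin n) ℤ} (h : A.charpoly.comp (-X) = (-1) ^ n * A.charpoly) :
    A.det = 0 := by
  have h0 := congrArg (Polynomial.eval 0) h
  simp only [eval_comp, eval_neg, eval_X, neg_zero, hn.neg_one_pow, neg_mul, one_mul] at h0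
  rw [det_eq_sign_charpoly_coeff, coeff_zero_eq_eval_zero, self_eq_neg.mp h0, mul_zero]

theorem stmt_12 (n : ℕ) (hn : 0 < n) (hmod : n % 4 = 3)
    (S : Matrix (Fin n) (Fin n) ℤ) (hS : IsSeidel S) :
    S.det ≠ 0 ∧ S.charpoly.comp (-X) ≠ (-1) ^ n * S.charpoly := by
  have hodd : Odd n := Nat.odd_iff.mpr (by omega)
  have hdet : S.det ≠ 0 := by
    intro h
    have h2 := hS.det_eq_numDerangements hodd
    rw [h, show n = 4 * (n / 4) + 3 by omega, numDerangements_four_mul_add_three] at h2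
    exact absurd h2 (by decide)
  exact ⟨hdet, fun h => hdet (Matrix.det_eq_zero_of_charpoly_comp_neg_X hodd h)⟩
end

section
/- For s ≥ 0, let Γₛ be the signed graph on vertex set {1, 2, 3, 4, 5, 6} ∪ S, where S is a set of s additional vertices, whose adjacency matrix A (symmetric integer matrix with zero diagonal) is given by: A(1,2) = A(2,3) = A(3,4) = A(4,5) = A(5,6) = A(1,6) = A(4,6) = 1 (positive edges), A(1,4) = −1 (a negative edge), A(u,1) = A(u,5) = 1 for every u ∈ S (positive edges), and all other off-diagonal entries 0. Then A has symmetric spectrum; that is, its characteristic polynomial p satisfies p(−x) = (−1)^(6+s) · p(x). -/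
open Polynomial Matrix

/-- The 6-vertex part of the signed graph `Γₛ`: positive edges
12, 23, 34, 45, 56, 16, 46 and the negative edge 14 (vertices are `0,…,5`). -/
def gammaCore : Matrix (Fin 6) (Fin 6) ℤ :=
  !![ 0,  1,  0, -1,  0,  1;
      1,  0,  1,  0,  0,  0;
      0,  1,  0,  1,  0,  0;
     -1,  0,  1,  0,  1,  1;
      0,  0,  0,  1,  0,  1;
      1,  0,  0,  1,  1,  0]

/-- The adjacency matrix of `Γₛ`: each of the `s` extra vertices is joined
by positive edges to vertices `1` and `5` (indices `0` and `4`). -/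
def gammaS (s : ℕ) : Matrix (Fin 6 ⊕ Fin s) (Fin 6 ⊕ Fin s) ℤ :=
  Matrix.fromBlocks gammaCore
    (Matrix.of fun i _ => if i = 0 ∨ i = 4 then 1 else 0)
    (Matrix.of fun _ j => if j = 0 ∨ j = 4 then 1 else 0) 0

/-- The matrix `x (x I - C) - t v vᵀ`, with `C = gammaCore` and `v` the indicator of `{0, 4}`:
for `t = s` this is `x` times the Schur complement of the block `x I` in `x I - gammaS s`. -/
def gammaSchur {R : Type*} [CommRing R] (x t : R) : Matrix (Fin 6) (Fin 6) R :=
  !![x * x - t, -x, 0, x, -t, -x;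
     -x, x * x, -x, 0, 0, 0;
     0, -x, x * x, -x, 0, 0;
     x, 0, -x, x * x, -x, -x;
     -t, 0, 0, -x, x * x - t, -x;
     -x, 0, 0, -x, -x, x * x]

set_option maxHeartbeats 1000000 in
theorem det_gammaSchur_neg {R : Type*} [CommRing R] (x t : R) :
    (gammaSchur (-x) t).det = (gammaSchur x t).det := by
  simp [gammaSchur, det_succ_row_zero, Fin.sum_univ_succ, Fin.succAbove]
  ring

theorem charpoly_mul_X_pow_card_of_charmatrix_mul {R m n : Type*} [CommRing R] [Fintype m]
    [Fintype n] [DecidableEq m] [DecidableEq n] {M : Matrix (m ⊕ n) (m ⊕ n) R}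
    {B : Matrix m n R[X]} {C : Matrix n m R[X]} {G : Matrix m m R[X]}
    (h : charmatrix M * fromBlocks ((X : R[X]) • (1 : Matrix m m R[X])) 0 C 1 =
      fromBlocks G B 0 ((X : R[X]) • (1 : Matrix n n R[X]))) :
    M.charpoly * X ^ Fintype.card m = G.det * X ^ Fintype.card n := by
  simpa [Matrix.charpoly] using congrArg det h

theorem gammaS_charpoly_mul (s : ℕ) :
    (gammaS s).charpoly * X ^ 6 = (gammaSchur (X : ℤ[X]) (s : ℤ[X])).det * X ^ s := by
  let B : Matrix (Fin 6) (Fin s) ℤ[X] := of fun i _ => if i = 0 ∨ i = 4 then 1 else 0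
  have hM : charmatrix (gammaS s) *
      fromBlocks ((X : ℤ[X]) • (1 : Matrix (Fin 6) (Fin 6) ℤ[X])) 0 Bᵀ 1 =
      fromBlocks (gammaSchur X (s : ℤ[X])) (-B) 0
        ((X : ℤ[X]) • (1 : Matrix (Fin s) (Fin s) ℤ[X])) := by
    rw [gammaS, charmatrix_fromBlocks, fromBlocks_multiply]
    congr 1
    · ext1 i j
      fin_cases i <;> fin_cases j <;>
        simp [B, gammaSchur, gammaCore, Matrix.mul_apply, sub_eq_add_neg]
    · ext1 i j
      by_cases h : i = 0 ∨ i = 4 <;> simp [B, h]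
    · ext1 i j
      by_cases h : j = 0 ∨ j = 4 <;> simp [B, h, charmatrix]
    · ext1 i j
      simp [charmatrix, diagonal_apply, Matrix.one_apply]
  have hdet := charpoly_mul_X_pow_card_of_charmatrix_mul hM
  rw [Fintype.card_fin, Fintype.card_fin] at hdet
  convert hdet using 2

theorem stmt_14 (s : ℕ) :
    (gammaS s).charpoly.comp (-X) = (-1) ^ (6 + s) * (gammaS s).charpoly := by
  have h := gammaS_charpoly_mul s
  have hq : (gammaSchur (X : ℤ[X]) (s : ℤ[X])).det.comp (-X) =
      (gammaSchur (X : ℤ[X]) (s : ℤ[X])).det := by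
    rw [← coe_compRingHom_apply, RingHom.map_det]
    rw [← det_gammaSchur_neg]
    congr 1
    ext1 i j
    fin_cases i <;> fin_cases j <;> simp [gammaSchur]
  have h' := congrArg (fun p : ℤ[X] => p.comp (-X)) h
  simp only [mul_comp, pow_comp, X_comp, hq] at h'
  refine mul_right_cancel₀ (pow_ne_zero 6 (X_ne_zero (R := ℤ))) ?_
  rw [mul_assoc, h]
  rw [neg_pow (X : ℤ[X]) s] at h'
  linear_combination h'
end

section
/- For s ≥ 0, let Γₛ be the signed graph on vertex set {1, 2, 3, 4, 5, 6} ∪ S, where S is a set of s additional vertices, whose adjacency matrix A (symmetric integer matrix with zero diagonal) is given by: A(1,2) = A(2,3) = A(3,4) = A(4,5) = A(5,6) = A(1,6) = A(4,6) = 1, A(1,4) = −1, A(u,1) = A(u,5) = 1 for every u ∈ S, and all other off-diagonal entries 0. Then Γₛ is not sign-symmetric: there is no signed permutation matrix P of order 6 + s with P · A · Pᵀ = −A. -/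
open Matrix

/-- Entrywise form of `P * A * Pᵀ = -A` for a signed permutation matrix `P`. -/
theorem IsSignedPerm.exists_perm_entries {m : Type*} [Fintype m] [DecidableEq m]
    {P A : Matrix m m ℤ} (hP : IsSignedPerm P) (h : P * A * Pᵀ = -A) :
    ∃ (σ : Equiv.Perm m) (ε : m → ℤ), (∀ i, ε i * ε i = 1) ∧
      ∀ i j, A (σ i) (σ j) = -(ε i * ε j * A i j) := by
  obtain ⟨σ, ε, hε, hP⟩ := hP
  have hsq : ∀ i, ε i * ε i = 1 := fun i => by rcases hε i with h | h <;> simp [h]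
  refine ⟨σ, ε, hsq, fun i j => ?_⟩
  have hij : ε i * A (σ i) (σ j) * ε j = -A i j := by
    simpa [Matrix.mul_apply, hP] using congrFun (congrFun h i) j
  linear_combination ε i * ε j * hij - A (σ i) (σ j) * ε j * ε j * hsq i
    - A (σ i) (σ j) * hsq j

/-- The signed number of closed walks of length three based at `i`. -/
def signedTriangles {m : Type*} [Fintype m] (A : Matrix m m ℤ) (i : m) : ℤ :=
  ∑ j, ∑ k, A i j * A j k * A k i

/-- The degree of `i` in the underlying unsigned graph. -/
def unsignedDegree {m : Type*} [Fintype m] (A : Matrix m m ℤ) (i : m) : ℤ :=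
  ∑ j, A i j * A i j

/-- In a sign-symmetric signed graph, the degree-weighted signed triangle count vanishes. -/
theorem sum_signedTriangles_mul_unsignedDegree_eq_zero {m : Type*} [Fintype m] [DecidableEq m]
    {P A : Matrix m m ℤ} (hP : IsSignedPerm P) (h : P * A * Pᵀ = -A) :
    ∑ i, signedTriangles A i * unsignedDegree A i = 0 := by
  obtain ⟨σ, ε, hε, hA⟩ := hP.exists_perm_entries h
  have hT : ∀ i, signedTriangles A (σ i) = -signedTriangles A i := fun i => by
    simp only [signedTriangles]
    rw [← Equiv.sum_comp σ, ← Finset.sum_neg_distrib]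
    refine Finset.sum_congr rfl fun j _ => ?_
    rw [← Equiv.sum_comp σ, ← Finset.sum_neg_distrib]
    refine Finset.sum_congr rfl fun k _ => ?_
    rw [hA, hA, hA]
    linear_combination (-(A i j * A j k * A k i)) *
      (ε j * ε j * ε k * ε k * hε i + ε k * ε k * hε j + hε k)
  have hD : ∀ i, unsignedDegree A (σ i) = unsignedDegree A i := fun i => by
    simp only [unsignedDegree]
    rw [← Equiv.sum_comp σ]
    refine Finset.sum_congr rfl fun j _ => ?_
    rw [hA]
    linear_combination (A i j * A i j) * (ε j * ε j * hε i + hε j)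
  have hsum := Equiv.sum_comp σ fun i => signedTriangles A i * unsignedDegree A i
  simp only [hT, hD, neg_mul, Finset.sum_neg_distrib] at hsum
  linarith

theorem sum_signedTriangles_mul_unsignedDegree_gammaS (s : ℕ) :
    ∑ i, signedTriangles (gammaS s) i * unsignedDegree (gammaS s) i = -2 := by
  simp [signedTriangles, unsignedDegree, Fintype.sum_sum_type, Fin.sum_univ_six, gammaS,
    gammaCore]
  ring

theorem stmt_15 (s : ℕ) :
    ¬ ∃ P : Matrix (Fin 6 ⊕ Fin s) (Fin 6 ⊕ Fin s) ℤ,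
        IsSignedPerm P ∧ P * gammaS s * Pᵀ = -(gammaS s) := by
  rintro ⟨P, hP, h⟩
  have hzero := sum_signedTriangles_mul_unsignedDegree_eq_zero hP h
  rw [sum_signedTriangles_mul_unsignedDegree_gammaS] at hzero
  norm_num at hzero
end

section
/- Let G be the graph on vertex set {1, …, 8} whose edges are {1,2}, {1,3}, {2,3}, {4,5}, {4,6}, {5,6}, {7,8} (the disjoint union of two triangles and one edge), with (0,1)-adjacency matrix B, and let S = J − I − 2B be its Seidel matrix of order 8. Then S is not sign-symmetric: there is no signed permutation matrix P of order 8 with P · S · Pᵀ = −S. -/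
open Matrix

/-- The adjacency matrix of the disjoint union of two triangles and one edge
on vertices `0,…,7` (triangles `012` and `345`, edge `67`). -/
def twoTrianglesEdge : Matrix (Fin 8) (Fin 8) ℤ :=
  !![0, 1, 1, 0, 0, 0, 0, 0;
     1, 0, 1, 0, 0, 0, 0, 0;
     1, 1, 0, 0, 0, 0, 0, 0;
     0, 0, 0, 0, 1, 1, 0, 0;
     0, 0, 0, 1, 0, 1, 0, 0;
     0, 0, 0, 1, 1, 0, 0, 0;
     0, 0, 0, 0, 0, 0, 0, 1;
     0, 0, 0, 0, 0, 0, 1, 0]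

/-- The Seidel matrix `S = J - I - 2B` of the above graph. -/
def seidel8 : Matrix (Fin 8) (Fin 8) ℤ :=
  (Matrix.of fun _ _ => 1) - 1 - 2 • twoTrianglesEdge

theorem IsSignedPerm.transpose_mul_self {m : Type*} [Fintype m] [DecidableEq m]
    {P : Matrix m m ℤ} (hP : IsSignedPerm P) : Pᵀ * P = 1 := by
  obtain ⟨σ, ε, hε, hP⟩ := hP
  rw [mul_eq_one_comm]
  ext i j
  have hi : ε i * ε i = 1 := by rcases hε i with h | h <;> simp [h]
  rcases eq_or_ne i j with rfl | hij
  · simp [mul_apply, hP, hi]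
  · simp [mul_apply, hP, hij, hij.symm]

/-- The trace of the cube of a sign-symmetric matrix vanishes. -/
theorem IsSignedPerm.trace_cube_eq_zero {m : Type*} [Fintype m] [DecidableEq m]
    {P A : Matrix m m ℤ} (hP : IsSignedPerm P) (h : P * A * Pᵀ = -A) :
    (A * A * A).trace = 0 := by
  have hPP := hP.transpose_mul_self
  have hcube : P * (A * A * A) * Pᵀ = -(A * A * A) := by
    calc P * (A * A * A) * Pᵀ
        = P * A * (Pᵀ * P) * A * (Pᵀ * P) * A * Pᵀ := by
          simp only [hPP, Matrix.mul_one, Matrix.mul_assoc]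
      _ = (P * A * Pᵀ) * (P * A * Pᵀ) * (P * A * Pᵀ) := by
          simp only [Matrix.mul_assoc]
      _ = -(A * A * A) := by simp [h]
  have htr := congrArg trace hcube
  rw [trace_mul_comm, ← Matrix.mul_assoc, hPP, Matrix.one_mul, trace_neg] at htr
  lia

theorem trace_seidel8_cube : (seidel8 * seidel8 * seidel8).trace = -120 := by
  decide +kernel

theorem stmt_17 :
    ¬ ∃ P : Matrix (Fin 8) (Fin 8) ℤ,
        IsSignedPerm P ∧ P * seidel8 * Pᵀ = -seidel8 := by
  rintro ⟨P, hP, h⟩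
  have h0 := hP.trace_cube_eq_zero h
  rw [trace_seidel8_cube] at h0
  norm_num at h0
end
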